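/- arXiv:0802.2978 — 2 statements merged into one kernel-verified Lean document; each statement's English description precedes it below -/
import Mathlib

section
/- Let λ > 0 and φ > 0 be real numbers, let n ≥ 2 be a natural number, and let x̃ : ℝ → ℝ be (n−1)-times continuously differentiable with |Σ_{i=0}^{n−1} C(n−1, i)·λ^{n−1−i}·x̃⁽ⁱ⁾(t)| ≤ φ for all t ≥ 0, where x̃⁽ⁱ⁾ denotes the i-th derivative of x̃ and C(n−1,i) the binomial coefficient. Then limsup_{t→∞} |x̃'(t)| ≤ 2φ/λ^{n−2}; that is, for every ε > 0 there exists T ≥ 0 such that |x̃'(t)| ≤ 2φ/λ^{n−2} + ε for all t ≥ T. -/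
open Filter Topology in
/-- One-sided comparison for `x' + c x`: eventual upper bounds pass to `x`. -/
theorem eventually_le_of_deriv_add_mul_le {c K : ℝ} (hc : 0 < c) {x : ℝ → ℝ}
    (hx : Differentiable ℝ x) (h : ∀ᶠ t in atTop, deriv x t + c * x t ≤ K)
    {ε : ℝ} (hε : 0 < ε) : ∀ᶠ t in atTop, x t ≤ K / c + ε := by
  obtain ⟨T, hT⟩ := eventually_atTop.1 h
  have hd : ∀ t, HasDerivAt (fun t => (x t - K / c) * Real.exp (c * t))
      ((deriv x t + c * x t - K) * Real.exp (c * t)) t := by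
    intro t
    have h1 := ((hx t).hasDerivAt.sub_const (K / c)).mul
      (((hasDerivAt_id t).const_mul c).exp)
    refine h1.congr_deriv ?_
    simp only [id]
    field_simp
    ring
  have hanti : AntitoneOn (fun t => (x t - K / c) * Real.exp (c * t)) (Set.Ici T) := by
    refine antitoneOn_of_deriv_nonpos (convex_Ici T)
      (fun t _ => (hd t).continuousAt.continuousWithinAt)
      (fun t _ => (hd t).differentiableAt.differentiableWithinAt) ?_
    intro t ht
    rw [interior_Ici] at ht
    rw [(hd t).deriv]
    exact mul_nonpos_of_nonpos_of_nonneg (by linarith [hT t (le_of_lt ht)]) (Real.exp_pos _).le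
  have hexp : Tendsto (fun t => ε * Real.exp (c * t)) atTop atTop :=
    (Real.tendsto_exp_atTop.comp (tendsto_id.const_mul_atTop hc)).const_mul_atTop hε
  filter_upwards [eventually_ge_atTop T,
    hexp.eventually_ge_atTop ((x T - K / c) * Real.exp (c * T))] with t ht hle
  have h1 : (x t - K / c) * Real.exp (c * t) ≤ ε * Real.exp (c * t) :=
    (hanti Set.self_mem_Ici ht ht).trans hle
  linarith [le_of_mul_le_mul_right h1 (Real.exp_pos _)]

open Filter in
theorem eventually_abs_le_of_deriv_add_mul {c M : ℝ} (hc : 0 < c) {x : ℝ → ℝ}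
    (hx : Differentiable ℝ x)
    (h : ∀ ε > 0, ∀ᶠ t in atTop, |deriv x t + c * x t| ≤ M + ε) :
    ∀ ε > 0, ∀ᶠ t in atTop, |x t| ≤ M / c + ε := by
  intro ε hε
  have hb := h (c * (ε / 2)) (by positivity)
  have hup := eventually_le_of_deriv_add_mul_le hc hx
    (hb.mono fun t ht => (abs_le.1 ht).2) (half_pos hε)
  have hlow := eventually_le_of_deriv_add_mul_le (K := M + c * (ε / 2)) (x := fun t => -x t) hc hx.neg
    (hb.mono fun t ht => by
      rw [deriv.fun_neg]
      linarith [(abs_le.1 ht).1]) (half_pos hε)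
  have hK : (M + c * (ε / 2)) / c = M / c + ε / 2 := by field_simp
  filter_upwards [hup, hlow] with t h1 h2
  rw [hK] at h1 h2
  exact abs_le.2 ⟨by linarith, by linarith⟩

/-- Pascal's rule for the coefficients of `(D + c) ^ (m + 1)`. -/
theorem sum_choose_succ_mul_pow (c : ℝ) (m : ℕ) (a : ℕ → ℝ) :
    ∑ i ∈ Finset.range (m + 2), ((m + 1).choose i : ℝ) * c ^ (m + 1 - i) * a i =
      ∑ i ∈ Finset.range (m + 1), (m.choose i : ℝ) * c ^ (m - i) * (a (i + 1) + c * a i) := by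
  have h1 : ∑ i ∈ Finset.range (m + 1), (m.choose i : ℝ) * c ^ (m - i) * (c * a i) =
      ∑ i ∈ Finset.range (m + 2), (m.choose i : ℝ) * c ^ (m + 1 - i) * a i := by
    rw [Finset.sum_range_succ _ (m + 1), Nat.choose_succ_self]
    simp only [Nat.cast_zero, zero_mul, add_zero]
    refine Finset.sum_congr rfl fun i hi => ?_
    rw [Nat.succ_sub (Nat.lt_succ_iff.1 (Finset.mem_range.1 hi)), pow_succ]
    ring
  simp only [mul_add, Finset.sum_add_distrib]
  rw [h1, Finset.sum_range_succ' _ (m + 1), Finset.sum_range_succ' _ (m + 1), ← add_assoc,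
    ← Finset.sum_add_distrib]
  congr 1
  · refine Finset.sum_congr rfl fun i _ => ?_
    rw [Nat.choose_succ_succ, Nat.add_sub_add_right]
    push_cast
    ring
  · simp

theorem contDiff_deriv_add_const_mul (c : ℝ) {m : ℕ} {x : ℝ → ℝ}
    (hx : ContDiff ℝ (m + 1 : ℕ) x) : ContDiff ℝ m (fun t => deriv x t + c * x t) := by
  have h1 : ContDiff ℝ m (deriv x) := ContDiff.deriv' (by exact_mod_cast hx)
  exact h1.add (contDiff_const.mul (hx.of_le (by exact_mod_cast Nat.le_succ m)))

theorem sum_choose_iteratedDeriv_succ (c : ℝ) {m : ℕ} {x : ℝ → ℝ}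
    (hx : ContDiff ℝ (m + 1 : ℕ) x) (t : ℝ) :
    ∑ i ∈ Finset.range (m + 2), ((m + 1).choose i : ℝ) * c ^ (m + 1 - i) * iteratedDeriv i x t =
      ∑ i ∈ Finset.range (m + 1), (m.choose i : ℝ) * c ^ (m - i) *
        iteratedDeriv i (fun t => deriv x t + c * x t) t := by
  rw [sum_choose_succ_mul_pow c m fun i => iteratedDeriv i x t]
  refine Finset.sum_congr rfl fun i hi => ?_
  have him : i ≤ m := Nat.lt_succ_iff.1 (Finset.mem_range.1 hi)
  have h1 : ContDiff ℝ m (deriv x) := ContDiff.deriv' (by exact_mod_cast hx)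
  have h2 : ContDiff ℝ i (deriv x) := h1.of_le (by exact_mod_cast him)
  have h3 : ContDiff ℝ i x := hx.of_le (by exact_mod_cast him.trans (Nat.le_succ m))
  rw [iteratedDeriv_fun_add h2.contDiffAt (contDiff_const.mul h3).contDiffAt,
    iteratedDeriv_const_mul_field, iteratedDeriv_succ']

open Filter in
/-- An asymptotic bound `M` on `(D + c) ^ m x` gives the asymptotic bound `M / c ^ m` on `x`. -/
theorem eventually_abs_le_of_sum_choose_iteratedDeriv {c M : ℝ} (hc : 0 < c) (m : ℕ)
    {x : ℝ → ℝ} (hx : ContDiff ℝ m x)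
    (h : ∀ ε > 0, ∀ᶠ t in atTop,
      |∑ i ∈ Finset.range (m + 1), (m.choose i : ℝ) * c ^ (m - i) * iteratedDeriv i x t|
        ≤ M + ε) :
    ∀ ε > 0, ∀ᶠ t in atTop, |x t| ≤ M / c ^ m + ε := by
  induction m generalizing x with
  | zero => simpa using h
  | succ m ih =>
    simp only [sum_choose_iteratedDeriv_succ c hx] at h
    have h1 := eventually_abs_le_of_deriv_add_mul hc
      (hx.differentiable (by simp)) (ih (contDiff_deriv_add_const_mul c hx) h)
    rwa [div_div, ← pow_succ] at h1

/-- Eq. 20: if the sliding variable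
`s = ∑_{i=0}^{n-1} C(n-1,i) λ^{n-1-i} x̃⁽ⁱ⁾` remains inside the boundary layer `|s| ≤ φ`
for all `t ≥ 0` (with `n ≥ 2`), then `limsup_{t→∞} |x̃'(t)| ≤ 2φ/λ^{n-2}` in the sense
that for every `ε > 0` eventually `|x̃'(t)| ≤ 2φ/λ^{n-2} + ε`. -/
theorem smc_tracking_error_deriv_bound (lam φ : ℝ) (hlam : 0 < lam) (hφ : 0 < φ)
    (n : ℕ) (hn : 2 ≤ n) (xt : ℝ → ℝ) (hxt : ContDiff ℝ (n - 1 : ℕ) xt)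
    (hs : ∀ t ≥ (0 : ℝ),
      |∑ i ∈ Finset.range n, ((n - 1).choose i : ℝ) * lam ^ (n - 1 - i) * iteratedDeriv i xt t|
        ≤ φ) :
    ∀ ε > (0 : ℝ), ∃ T ≥ (0 : ℝ), ∀ t ≥ T, |deriv xt t| ≤ 2 * φ / lam ^ (n - 2) + ε := by
  obtain ⟨m, rfl⟩ : ∃ m, n = m + 2 := ⟨n - 2, by omega⟩
  simp only [show m + 2 - 1 = m + 1 from rfl] at hxt hs
  simp only [Nat.add_sub_cancel]
  intro ε hε
  have hy : ∀ δ > 0, ∀ᶠ t in Filter.atTop, |deriv xt t + lam * xt t| ≤ φ / lam ^ m + δ := by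
    refine eventually_abs_le_of_sum_choose_iteratedDeriv hlam m
      (contDiff_deriv_add_const_mul lam hxt) fun δ hδ => ?_
    filter_upwards [Filter.eventually_ge_atTop 0] with t ht
    rw [← sum_choose_iteratedDeriv_succ lam hxt]
    exact (hs t ht).trans (by linarith)
  have hx := eventually_abs_le_of_deriv_add_mul hlam (hxt.differentiable (by simp)) hy
    (ε / 2 / lam) (by positivity)
  obtain ⟨T, hT⟩ := Filter.eventually_atTop.1 ((hy (ε / 2) (half_pos hε)).and hx)
  refine ⟨max T 0, le_max_right _ _, fun t ht => ?_⟩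
  obtain ⟨h1, h2⟩ := hT t ((le_max_left _ _).trans ht)
  have h3 : |lam * xt t| ≤ φ / lam ^ m + ε / 2 := by
    rw [abs_mul, abs_of_pos hlam]
    calc lam * |xt t| ≤ lam * (φ / lam ^ m / lam + ε / 2 / lam) := by gcongr
      _ = φ / lam ^ m + ε / 2 := by field_simp
  calc |deriv xt t| = |(deriv xt t + lam * xt t) - lam * xt t| := by rw [add_sub_cancel_right]
    _ ≤ |deriv xt t + lam * xt t| + |lam * xt t| := abs_sub _ _
    _ ≤ (φ / lam ^ m + ε / 2) + (φ / lam ^ m + ε / 2) := add_le_add h1 h3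
    _ = 2 * φ / lam ^ m + ε := by ring
end

section
/- Let λ > 0 and φ > 0 be real numbers, let n ≥ 1 be a natural number, and let x̃ : ℝ → ℝ be (n−1)-times continuously differentiable with |Σ_{i=0}^{n−1} C(n−1, i)·λ^{n−1−i}·x̃⁽ⁱ⁾(t)| ≤ φ for all t ≥ 0, where x̃⁽ⁱ⁾ denotes the i-th derivative of x̃ and C(n−1,i) the binomial coefficient. Define ζ : ℕ → ℕ by ζ₀ = 1 and ζᵢ = 1 + Σ_{j=0}^{i−1} C(i, j)·ζⱼ for i ≥ 1. Then for every i with 0 ≤ i ≤ n−1, limsup_{t→∞} |x̃⁽ⁱ⁾(t)| ≤ ζᵢ·λ^{i−n+1}·φ; that is, for every ε > 0 there exists T ≥ 0 such that |x̃⁽ⁱ⁾(t)| ≤ ζᵢ·λ^{i−n+1}·φ + ε for all t ≥ T. -/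
open Filter Topology

/-- If `y' + lam * y ≤ A` eventually, then `y` is eventually below `A / lam + ε`. -/
theorem eventually_le_of_deriv_add_mul_le_s15 {lam A : ℝ} (hlam : 0 < lam) {y y' : ℝ → ℝ}
    (hy : ∀ t, HasDerivAt y (y' t) t) (h : ∀ᶠ t in atTop, y' t + lam * y t ≤ A)
    {ε : ℝ} (hε : 0 < ε) : ∀ᶠ t in atTop, y t ≤ A / lam + ε := by
  obtain ⟨T, hT⟩ := eventually_atTop.1 h
  have hg : ∀ t, HasDerivAt (fun t => Real.exp (lam * t) * (y t - A / lam))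
      (Real.exp (lam * t) * (y' t + lam * y t - A)) t := fun t => by
    have h1 := (((hasDerivAt_id t).const_mul lam).exp).mul ((hy t).sub_const (A / lam))
    refine h1.congr_deriv ?_
    simp only [id]
    field_simp
    ring
  have hanti : AntitoneOn (fun t => Real.exp (lam * t) * (y t - A / lam)) (Set.Ici T) := by
    refine antitoneOn_of_deriv_nonpos (convex_Ici T)
      (fun t _ => (hg t).continuousAt.continuousWithinAt)
      (fun t _ => (hg t).differentiableAt.differentiableWithinAt) fun t ht => ?_
    rw [interior_Ici] at ht
    rw [(hg t).deriv]
    exact mul_nonpos_of_nonneg_of_nonpos (Real.exp_pos _).le (by linarith [hT t (le_of_lt ht)])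
  set c := Real.exp (lam * T) * (y T - A / lam)
  have hlim : Tendsto (fun t => Real.exp (-(lam * t)) * c) atTop (𝓝 0) := by
    have := (Real.tendsto_exp_neg_atTop_nhds_zero.comp
      (tendsto_id.const_mul_atTop hlam)).mul_const c
    simpa using this
  filter_upwards [hlim.eventually_lt_const hε, eventually_ge_atTop T] with t ht hTt
  have h2 := hanti Set.self_mem_Ici hTt hTt
  have h3 : y t - A / lam = Real.exp (-(lam * t)) * (Real.exp (lam * t) * (y t - A / lam)) := by
    rw [← mul_assoc, ← Real.exp_add]
    simp
  have h4 := mul_le_mul_of_nonneg_left h2 (Real.exp_pos (-(lam * t))).le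
  simp only at h4
  linarith

/-- A first-order stable filter divides the asymptotic bound on its input by its gain. -/
theorem eventually_abs_le_of_deriv_add_mul_s15 {lam B : ℝ} (hlam : 0 < lam) {y y' : ℝ → ℝ}
    (hy : ∀ t, HasDerivAt y (y' t) t)
    (h : ∀ ε > 0, ∀ᶠ t in atTop, |y' t + lam * y t| ≤ B + ε)
    {ε : ℝ} (hε : 0 < ε) : ∀ᶠ t in atTop, |y t| ≤ B / lam + ε := by
  have h1 := h (lam * (ε / 2)) (by positivity)
  have hA : (B + lam * (ε / 2)) / lam = B / lam + ε / 2 := by field_simp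
  have hu := eventually_le_of_deriv_add_mul_le_s15 hlam hy
    (h1.mono fun t ht => (abs_le.1 ht).2) (half_pos hε)
  have hl := eventually_le_of_deriv_add_mul_le_s15 (y := fun t => -y t) (y' := fun t => -y' t)
    (A := B + lam * (ε / 2)) hlam
    (fun t => (hy t).neg)
    (h1.mono fun t ht => by linarith [(abs_le.1 ht).1]) (half_pos hε)
  rw [hA] at hu hl
  filter_upwards [hu, hl] with t h2 h3
  exact abs_le.2 ⟨by linarith, by linarith⟩

/-- The expansion of `(d/dt + lam) ^ k` applied to `x`. -/
noncomputable def slidingVariable (lam : ℝ) (x : ℝ → ℝ) (k : ℕ) (t : ℝ) : ℝ :=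
  ∑ i ∈ Finset.range (k + 1), (k.choose i : ℝ) * lam ^ (k - i) * iteratedDeriv i x t

theorem slidingVariable_succ (lam : ℝ) (x : ℝ → ℝ) (k : ℕ) (t : ℝ) :
    slidingVariable lam x (k + 1) t =
      ∑ i ∈ Finset.range (k + 1), (k.choose i : ℝ) * lam ^ (k - i) * iteratedDeriv (i + 1) x t +
        lam * slidingVariable lam x k t := by
  have h := Finset.sum_choose_succ_mul (fun i j => lam ^ j * iteratedDeriv i x t) k
  simp only [← mul_assoc] at h
  rw [slidingVariable, h, slidingVariable, Finset.mul_sum, add_comm]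
  congr 1
  refine Finset.sum_congr rfl fun i hi => ?_
  rw [Nat.sub_add_comm (Finset.mem_range_succ_iff.1 hi), pow_succ]
  ring

theorem hasDerivAt_slidingVariable (lam : ℝ) {x : ℝ → ℝ} {m k : ℕ} (hx : ContDiff ℝ m x)
    (hk : k < m) (t : ℝ) :
    HasDerivAt (slidingVariable lam x k)
      (∑ i ∈ Finset.range (k + 1), (k.choose i : ℝ) * lam ^ (k - i) * iteratedDeriv (i + 1) x t)
      t := by
  refine HasDerivAt.fun_sum fun i hi => HasDerivAt.const_mul _ ?_
  rw [iteratedDeriv_succ]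
  refine (hx.differentiable_iteratedDeriv i ?_ t).hasDerivAt
  exact_mod_cast (Finset.mem_range_succ_iff.1 hi).trans_lt hk

theorem eventually_abs_slidingVariable_le {lam φ : ℝ} (hlam : 0 < lam) {x : ℝ → ℝ} {m : ℕ}
    (hx : ContDiff ℝ m x) (hs : ∀ᶠ t in atTop, |slidingVariable lam x m t| ≤ φ)
    {k : ℕ} (hk : k ≤ m) :
    ∀ ε > 0, ∀ᶠ t in atTop, |slidingVariable lam x k t| ≤ lam ^ ((k : ℤ) - m) * φ + ε := by
  induction hk using Nat.decreasingInduction with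
  | self =>
    intro ε hε
    filter_upwards [hs] with t ht
    simpa using ht.trans (by linarith)
  | @of_succ k hk ih =>
    intro ε hε
    have hB : lam ^ ((k : ℤ) - m) * φ = lam ^ (((k + 1 : ℕ) : ℤ) - m) * φ / lam := by
      rw [show ((k + 1 : ℕ) : ℤ) - m = (k - m) + 1 by push_cast; ring, zpow_add_one₀ hlam.ne']
      field_simp
    rw [hB]
    refine eventually_abs_le_of_deriv_add_mul_s15 hlam (hasDerivAt_slidingVariable lam hx hk) ?_ hε
    simpa only [slidingVariable_succ] using ih

theorem eventually_abs_iteratedDeriv_le {lam φ : ℝ} (hlam : 0 < lam) {x : ℝ → ℝ} {m : ℕ}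
    (hx : ContDiff ℝ m x) (hs : ∀ᶠ t in atTop, |slidingVariable lam x m t| ≤ φ)
    {ζ : ℕ → ℕ} (hζ : ∀ i, ζ i = 1 + ∑ j ∈ Finset.range i, i.choose j * ζ j)
    {i : ℕ} (hi : i ≤ m) :
    ∀ ε > 0, ∀ᶠ t in atTop, |iteratedDeriv i x t| ≤ ζ i * lam ^ ((i : ℤ) - m) * φ + ε := by
  induction i using Nat.strong_induction_on with
  | _ i ih =>
    intro ε hε
    set C := 1 + ∑ j ∈ Finset.range i, (i.choose j : ℝ) * lam ^ (i - j) with hC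
    have hCpos : 0 < C := by positivity
    have hδ : 0 < ε / C := by positivity
    have hlow : ∀ᶠ t in atTop, ∀ j ∈ Finset.range i,
        |iteratedDeriv j x t| ≤ ζ j * lam ^ ((j : ℤ) - m) * φ + ε / C :=
      (Finset.eventually_all _).2 fun j hj =>
        ih j (Finset.mem_range.1 hj) ((Finset.mem_range.1 hj).le.trans hi) _ hδ
    filter_upwards [hlow, eventually_abs_slidingVariable_le hlam hx hs hi _ hδ] with t h1 h2
    have hsplit : iteratedDeriv i x t = slidingVariable lam x i t -
        ∑ j ∈ Finset.range i, (i.choose j : ℝ) * lam ^ (i - j) * iteratedDeriv j x t := by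
      simp [slidingVariable, Finset.sum_range_succ]
    have hsum : |∑ j ∈ Finset.range i, (i.choose j : ℝ) * lam ^ (i - j) * iteratedDeriv j x t| ≤
        ∑ j ∈ Finset.range i, (i.choose j : ℝ) * lam ^ (i - j) *
          (ζ j * lam ^ ((j : ℤ) - m) * φ + ε / C) := by
      refine (Finset.abs_sum_le_sum_abs _ _).trans (Finset.sum_le_sum fun j hj => ?_)
      rw [abs_mul, abs_of_nonneg (by positivity : (0 : ℝ) ≤ i.choose j * lam ^ (i - j))]
      exact mul_le_mul_of_nonneg_left (h1 j hj) (by positivity)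
    have hval : ∑ j ∈ Finset.range i, (i.choose j : ℝ) * lam ^ (i - j) *
          (ζ j * lam ^ ((j : ℤ) - m) * φ + ε / C) =
        (∑ j ∈ Finset.range i, (i.choose j : ℝ) * ζ j) * (lam ^ ((i : ℤ) - m) * φ) +
          (C - 1) * (ε / C) := by
      rw [hC, add_sub_cancel_left, ← hC, Finset.sum_mul, Finset.sum_mul, ← Finset.sum_add_distrib]
      refine Finset.sum_congr rfl fun j hj => ?_
      have hpow : lam ^ ((i : ℤ) - m) = lam ^ (i - j) * lam ^ ((j : ℤ) - m) := by
        rw [← zpow_natCast, ← zpow_add₀ hlam.ne', Nat.cast_sub (Finset.mem_range.1 hj).le]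
        congr 1
        ring
      rw [hpow]
      ring
    have hCε : (C - 1) * (ε / C) = ε - ε / C := by field_simp
    have hζi : (ζ i : ℝ) = 1 + ∑ j ∈ Finset.range i, (i.choose j : ℝ) * ζ j := by
      rw [hζ i]
      push_cast
      rfl
    rw [hval, hCε] at hsum
    rw [hsplit, hζi]
    refine (abs_sub _ _).trans ((add_le_add h2 hsum).trans (le_of_eq ?_))
    ring

/-- Theorem 2: if the sliding variable
`s = ∑_{i=0}^{n-1} C(n-1,i) λ^{n-1-i} x̃⁽ⁱ⁾` remains inside the boundary layer `|s| ≤ φ`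
for all `t ≥ 0`, and `ζ` is defined by `ζ 0 = 1`, `ζ i = 1 + ∑_{j<i} C(i,j) ζ j`, then for
every `0 ≤ i ≤ n-1`, `limsup_{t→∞} |x̃⁽ⁱ⁾(t)| ≤ ζᵢ·λ^{i-n+1}·φ` in the sense that for
every `ε > 0` eventually `|x̃⁽ⁱ⁾(t)| ≤ ζᵢ·λ^{i-n+1}·φ + ε`. -/
theorem smc_tracking_error_all_bounds (lam φ : ℝ) (hlam : 0 < lam) (hφ : 0 < φ)
    (n : ℕ) (hn : 1 ≤ n) (xt : ℝ → ℝ) (hxt : ContDiff ℝ (n - 1 : ℕ) xt)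
    (hs : ∀ t ≥ (0 : ℝ),
      |∑ i ∈ Finset.range n, ((n - 1).choose i : ℝ) * lam ^ (n - 1 - i) * iteratedDeriv i xt t|
        ≤ φ)
    (ζ : ℕ → ℕ) (hζ0 : ζ 0 = 1)
    (hζ : ∀ i, 1 ≤ i → ζ i = 1 + ∑ j ∈ Finset.range i, i.choose j * ζ j) :
    ∀ i ≤ n - 1, ∀ ε > (0 : ℝ), ∃ T ≥ (0 : ℝ), ∀ t ≥ T,
      |iteratedDeriv i xt t| ≤ (ζ i : ℝ) * lam ^ ((i : ℤ) - n + 1) * φ + ε := by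
  obtain ⟨m, rfl⟩ : ∃ m, n = m + 1 := ⟨n - 1, by omega⟩
  simp only [Nat.add_sub_cancel] at hxt hs ⊢
  intro i hi ε hε
  have hζ' : ∀ i, ζ i = 1 + ∑ j ∈ Finset.range i, i.choose j * ζ j := fun i => by
    rcases Nat.eq_zero_or_pos i with rfl | h
    · simpa using hζ0
    · exact hζ i h
  obtain ⟨T, hT⟩ := eventually_atTop.1 (eventually_abs_iteratedDeriv_le hlam hxt
    ((eventually_ge_atTop 0).mono hs) hζ' hi ε hε)
  refine ⟨max T 0, le_max_right _ _, fun t ht => ?_⟩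
  have h := hT t ((le_max_left _ _).trans ht)
  rwa [show (i : ℤ) - (m + 1 : ℕ) + 1 = i - m by push_cast; ring]
end
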